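/- Under assumptions (A.1)–(A.4), let G* be a Softmax–Laplace Gaussian HMoE mixing measure with k₁* groups and k₂* experts per group, let (X₁,Y₁),…,(Xₙ,Yₙ) be i.i.d. with each Xᵢ distributed according to a probability measure μ on ℝ^d with bounded support and Yᵢ given Xᵢ = x distributed with density p^SL_{G*}(·|x), and for k₂ > k₂* let Ĝₙ be any maximizer over G ∈ 𝒢_{k₁*,k₂}(Θ) of the empirical log-likelihood (1/n)·Σ_{i=1}^n log p^SL_G(Yᵢ|Xᵢ). Then there exist universal constants C₁, c₁, C₂ > 0 such that for every n ≥ 2, the probability that E_{X∼μ}[ h(p^SL_{Ĝₙ}(·|X), p^SL_{G*}(·|X)) ] > C₁·√(log n / n) is at most C₂·exp(−c₁·log n). -/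

import Mathlib

open scoped RealInnerProductSpace

noncomputable section

/-- Euclidean input space `ℝ^d`. -/
abbrev Euc (d : ℕ) := EuclideanSpace ℝ (Fin d)

/-- Univariate Gaussian density `π(y|μ,ν) = (2πν)^(-1/2) exp(-(y-μ)²/(2ν))`. -/
def gaussPDF (m v y : ℝ) : ℝ :=
  (Real.sqrt (2 * Real.pi * v))⁻¹ * Real.exp (-(y - m) ^ 2 / (2 * v))

/-- Parameters of a two-level Gaussian HMoE with `k1` groups and `k2` experts per group:
first-level gating parameters `(b_{i₁}, a_{i₁})`, second-level gating parameters
`(β_{i₂|i₁}, ω_{i₂|i₁})`, and expert parameters `(η_{i₁i₂}, τ_{i₁i₂}, ν_{i₁i₂})`. -/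
structure HMoE (d k1 k2 : ℕ) where
  b : Fin k1 → ℝ
  a : Fin k1 → Euc d
  β : Fin k1 → Fin k2 → ℝ
  ω : Fin k1 → Fin k2 → Euc d
  η : Fin k1 → Fin k2 → Euc d
  τ : Fin k1 → Fin k2 → ℝ
  ν : Fin k1 → Fin k2 → ℝ

/-- Conditional density of the Softmax–Laplace Gaussian HMoE. -/
def pSL {d k1 k2 : ℕ} (P : HMoE d k1 k2) (x : Euc d) (y : ℝ) : ℝ :=
  ∑ i1, (Real.exp (⟪P.a i1, x⟫ + P.b i1) /
      ∑ j1, Real.exp (⟪P.a j1, x⟫ + P.b j1)) *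
    ∑ i2, (Real.exp (-‖P.ω i1 i2 - x‖ + P.β i1 i2) /
        ∑ j2, Real.exp (-‖P.ω i1 j2 - x‖ + P.β i1 j2)) *
      gaussPDF (⟪P.η i1 i2, x⟫ + P.τ i1 i2) (P.ν i1 i2) y

open MeasureTheory

/-- All parameter tuples `(b, a, β, ω, η, τ, ν)` of `P` lie in the parameter space `Θ`. -/
def inParamSpace {d k1 k2 : ℕ}
    (Θ : Set (ℝ × Euc d × ℝ × Euc d × Euc d × ℝ × ℝ)) (P : HMoE d k1 k2) : Prop :=
  ∀ i1 i2, (P.b i1, P.a i1, P.β i1 i2, P.ω i1 i2, P.η i1 i2, P.τ i1 i2, P.ν i1 i2) ∈ Θ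

/-- A candidate mixing measure with `k1` groups and an arbitrary number of experts per
group (encoded by the first component). -/
def Candidate (d k1 : ℕ) := Σ k2' : ℕ, HMoE d k1 k2'

/-- The class `𝒢_{k1,k2}(Θ)` of candidate mixing measures: at most `k2` (and at least one)
experts per group, with all parameters in `Θ`. -/
def candClass (d k1 k2 : ℕ) (Θ : Set (ℝ × Euc d × ℝ × Euc d × Euc d × ℝ × ℝ)) :
    Set (Candidate d k1) :=
  {c | 1 ≤ c.1 ∧ c.1 ≤ k2 ∧ inParamSpace Θ c.2}

/-- Hellinger distance between two conditional densities on `ℝ`: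
`h(p, q) = ( (1/2) ∫ (√p − √q)² )^{1/2}`. -/
def hellingerDist (p q : ℝ → ℝ) : ℝ :=
  Real.sqrt ((1 / 2) * ∫ y : ℝ, (Real.sqrt (p y) - Real.sqrt (q y)) ^ 2)

/-- Joint distribution of a pair `(X, Y)` where `X ∼ μ` and `Y | X = x` has Lebesgue
density `p x ·`. -/
def jointMeasure {d : ℕ} (μ : Measure (Euc d)) (p : Euc d → ℝ → ℝ) :
    Measure (Euc d × ℝ) :=
  (μ.prod volume).withDensity fun z => ENNReal.ofReal (p z.1 z.2)

/-! ### Covering -/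

lemma exists_cover {V : Type*} [NormedAddCommGroup V] [NormedSpace ℝ V] [FiniteDimensional ℝ V]
    (S : Set V) (hS : Bornology.IsBounded S) :
    ∃ (A : ℝ) (D : ℕ), 0 ≤ A ∧ ∀ n : ℕ, 1 ≤ n → ∀ B ⊆ S, ∃ T : Finset V, (∀ t ∈ T, t ∈ B) ∧
      (T.card : ℝ) ≤ A * (n : ℝ) ^ D ∧ ∀ x ∈ B, ∃ t ∈ T, ‖x - t‖ ≤ 1 / (n : ℝ) ^ 2 := by
  classical
  set m := Module.finrank ℝ V with hm
  let e : V ≃L[ℝ] (Fin m → ℝ) :=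
    ContinuousLinearEquiv.ofFinrankEq (by simp [hm])
  obtain ⟨M0, hM0⟩ := hS.exists_norm_le
  obtain ⟨K, hK⟩ := exists_nat_gt ‖(e.symm : (Fin m → ℝ) →L[ℝ] V)‖
  obtain ⟨M, hM⟩ := exists_nat_gt (‖(e : V →L[ℝ] (Fin m → ℝ))‖ * M0)
  have hKpos : 0 < (K : ℝ) := lt_of_le_of_lt (norm_nonneg _) hK
  have hKsymm : ∀ w, ‖e.symm w‖ ≤ K * ‖w‖ := fun w =>
    ((e.symm : (Fin m → ℝ) →L[ℝ] V).le_opNorm w).trans (by gcongr)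
  have heM : ∀ x ∈ S, ∀ i, |e x i| ≤ M := fun x hx i => by
    have h1 : ‖e x i‖ ≤ ‖e x‖ := norm_le_pi_norm _ i
    have h2 := (e : V →L[ℝ] (Fin m → ℝ)).le_opNorm x
    have h3 : ‖(e : V →L[ℝ] (Fin m → ℝ))‖ * ‖x‖ ≤ ‖(e : V →L[ℝ] (Fin m → ℝ))‖ * M0 := by
      gcongr; exact hM0 x hx
    rw [← Real.norm_eq_abs]
    exact h1.trans (h2.trans (h3.trans hM.le))
  refine ⟨((2 * K * M + 2 : ℕ) : ℝ) ^ m, 2 * m, by positivity, ?_⟩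
  intro n hn B hB
  let q : V → (Fin m → ℤ) := fun x i => ⌊(K : ℝ) * (n : ℝ) ^ 2 * e x i⌋
  let R : Finset (Fin m → ℤ) :=
    Fintype.piFinset fun _ => Finset.Ico (-((K * n ^ 2 * M : ℕ) : ℤ)) (K * n ^ 2 * M + 1 : ℕ)
  have hq : ∀ x ∈ B, q x ∈ R := by
    intro x hx
    simp only [R, q, Fintype.mem_piFinset, Finset.mem_Ico]
    intro i
    have h := abs_le.1 (heM x (hB hx) i)
    have hc : 0 ≤ (K : ℝ) * (n : ℝ) ^ 2 := by positivity
    constructor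
    · rw [Int.le_floor]; push_cast; nlinarith
    · rw [Int.floor_lt]; push_cast; nlinarith
  let J := R.filter fun j => ∃ x ∈ B, q x = j
  have hJ : ∀ j : J, ∃ x ∈ B, q x = j := fun j => (Finset.mem_filter.1 j.2).2
  choose c hcB hcq using hJ
  refine ⟨Finset.univ.image c, ?_, ?_, ?_⟩
  · intro t ht
    obtain ⟨j, -, rfl⟩ := Finset.mem_image.1 ht
    exact hcB j
  · have h1 : (Finset.univ.image c).card ≤ R.card := by
      refine Finset.card_image_le.trans ?_
      simp only [Finset.card_univ, Fintype.card_coe]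
      exact Finset.card_filter_le _ _
    have h2 : R.card = (2 * K * M * n ^ 2 + 1) ^ m := by
      simp only [R, Fintype.card_piFinset, Int.card_Ico, Finset.prod_const, Finset.card_univ,
        Fintype.card_fin]
      congr 1
      push_cast
      have : ((K : ℤ) * n ^ 2 * M + 1 - -(K * n ^ 2 * M)) = ((2 * K * M * n ^ 2 + 1 : ℕ) : ℤ) := by
        push_cast; ring
      rw [this, Int.toNat_natCast]
    have h3 : R.card ≤ (2 * K * M + 2) ^ m * n ^ (2 * m) := by
      rw [h2, pow_mul, ← mul_pow]
      gcongr
      have : 1 ≤ n ^ 2 := Nat.one_le_pow _ _ hn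
      nlinarith
    exact_mod_cast h1.trans h3
  · intro x hx
    have hxJ : q x ∈ J := Finset.mem_filter.2 ⟨hq x hx, x, hx, rfl⟩
    refine ⟨c ⟨q x, hxJ⟩, Finset.mem_image_of_mem _ (Finset.mem_univ _), ?_⟩
    have hn' : 0 < (n : ℝ) := by exact_mod_cast hn
    have hcc := hcq ⟨q x, hxJ⟩
    set t := c ⟨q x, hxJ⟩
    have h1 : ‖e (x - t)‖ ≤ 1 / (K * (n : ℝ) ^ 2) := by
      rw [pi_norm_le_iff_of_nonneg (by positivity)]
      intro i
      have h := congrFun hcc i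
      have h' := Int.abs_sub_lt_one_of_floor_eq_floor h
      rw [← mul_sub, abs_mul, abs_of_pos (by positivity)] at h'
      rw [le_div_iff₀ (by positivity), map_sub, Pi.sub_apply, Real.norm_eq_abs, abs_sub_comm]
      linarith
    calc ‖x - t‖ = ‖e.symm (e (x - t))‖ := by simp
      _ ≤ K * ‖e (x - t)‖ := hKsymm _
      _ ≤ K * (1 / (K * (n : ℝ) ^ 2)) := by gcongr
      _ = _ := by field_simp

set_option linter.unusedSectionVars false

/-! ### Basic facts on the densities -/

lemma gaussPDF_pos {m v : ℝ} (hv : 0 < v) (y : ℝ) : 0 < gaussPDF m v y := by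
  unfold gaussPDF
  have := Real.pi_pos
  positivity

lemma gaussPDF_eq {m v : ℝ} (hv : 0 ≤ v) :
    gaussPDF m v = ProbabilityTheory.gaussianPDFReal m ⟨v, hv⟩ := by
  funext y
  rfl

lemma gaussPDF_integrable {m v : ℝ} (hv : 0 < v) : Integrable (gaussPDF m v) := by
  rw [gaussPDF_eq hv.le]
  exact ProbabilityTheory.integrable_gaussianPDFReal _ _

lemma gaussPDF_integral {m v : ℝ} (hv : 0 < v) : ∫ y, gaussPDF m v y = 1 := by
  rw [gaussPDF_eq hv.le]
  refine ProbabilityTheory.integral_gaussianPDFReal_eq_one _ ?_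
  intro h
  exact hv.ne' (congrArg NNReal.toReal h)

lemma gaussPDF_sq {m v : ℝ} (hv : 0 < v) :
    Integrable (fun y => gaussPDF m v y * y ^ 2) ∧ ∫ y, gaussPDF m v y * y ^ 2 = m ^ 2 + v := by
  lift v to NNReal using hv.le
  have hv0 : v ≠ 0 := by rintro rfl; simp at hv
  have h1 : ∫ y, y ^ 2 ∂(ProbabilityTheory.gaussianReal m v) = m ^ 2 + v := by
    have h2 := ProbabilityTheory.variance_fun_id_gaussianReal (μ := m) (v := v)
    have hL : MemLp (fun y : ℝ => y) 2 (ProbabilityTheory.gaussianReal m v) :=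
      ProbabilityTheory.memLp_id_gaussianReal' 2 (by simp)
    rw [ProbabilityTheory.variance_eq_sub hL] at h2
    simp only [Pi.pow_apply, ProbabilityTheory.integral_id_gaussianReal] at h2
    linarith
  rw [ProbabilityTheory.integral_gaussianReal_eq_integral_smul hv0] at h1
  have h4 : ∫ y, gaussPDF m v y * y ^ 2 = m ^ 2 + v := h1
  refine ⟨?_, h4⟩
  by_contra h
  rw [integral_undef h] at h4
  nlinarith [sq_nonneg m]

/-- First-level gate. -/
def gate1 {d k1 k2 : ℕ} (P : HMoE d k1 k2) (x : Euc d) (i1 : Fin k1) : ℝ :=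
  Real.exp (⟪P.a i1, x⟫ + P.b i1) / ∑ j1, Real.exp (⟪P.a j1, x⟫ + P.b j1)

/-- Second-level gate. -/
def gate2 {d k1 k2 : ℕ} (P : HMoE d k1 k2) (x : Euc d) (i1 : Fin k1) (i2 : Fin k2) : ℝ :=
  Real.exp (-‖P.ω i1 i2 - x‖ + P.β i1 i2) / ∑ j2, Real.exp (-‖P.ω i1 j2 - x‖ + P.β i1 j2)

lemma pSL_eq {d k1 k2 : ℕ} (P : HMoE d k1 k2) (x : Euc d) (y : ℝ) :
    pSL P x y = ∑ i1, gate1 P x i1 * ∑ i2, gate2 P x i1 i2 *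
      gaussPDF (⟪P.η i1 i2, x⟫ + P.τ i1 i2) (P.ν i1 i2) y := rfl

section
variable {d k1 k2 : ℕ} [NeZero k1] [NeZero k2] (P : HMoE d k1 k2)

lemma sumexp_pos {k : ℕ} [NeZero k] (f : Fin k → ℝ) : 0 < ∑ j, Real.exp (f j) :=
  Finset.sum_pos (fun _ _ => Real.exp_pos _) ⟨0, Finset.mem_univ _⟩

lemma gate1_pos (x : Euc d) (i1 : Fin k1) : 0 < gate1 P x i1 :=
  div_pos (Real.exp_pos _) (sumexp_pos _)

lemma gate2_pos (x : Euc d) (i1 : Fin k1) (i2 : Fin k2) : 0 < gate2 P x i1 i2 :=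
  div_pos (Real.exp_pos _) (sumexp_pos _)

lemma gate1_sum (x : Euc d) : ∑ i1, gate1 P x i1 = 1 := by
  unfold gate1
  rw [← Finset.sum_div, div_self (sumexp_pos _).ne']

lemma gate2_sum (x : Euc d) (i1 : Fin k1) : ∑ i2, gate2 P x i1 i2 = 1 := by
  unfold gate2
  rw [← Finset.sum_div, div_self (sumexp_pos _).ne']

lemma pSL_pos (hP : ∀ i1 i2, 0 < P.ν i1 i2) (x : Euc d) (y : ℝ) : 0 < pSL P x y := by
  rw [pSL_eq]
  refine Finset.sum_pos (fun i1 _ => mul_pos (gate1_pos P x i1) ?_) ⟨0, Finset.mem_univ _⟩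
  exact Finset.sum_pos (fun i2 _ => mul_pos (gate2_pos P x i1 i2) (gaussPDF_pos (hP _ _) _))
    ⟨0, Finset.mem_univ _⟩

lemma pSL_integrable (hP : ∀ i1 i2, 0 < P.ν i1 i2) (x : Euc d) : Integrable (pSL P x) := by
  have : pSL P x = fun y => ∑ i1, gate1 P x i1 * ∑ i2, gate2 P x i1 i2 *
      gaussPDF (⟪P.η i1 i2, x⟫ + P.τ i1 i2) (P.ν i1 i2) y := rfl
  rw [this]
  refine integrable_finsetSum _ fun i1 _ => Integrable.const_mul ?_ _
  refine integrable_finsetSum _ fun i2 _ => Integrable.const_mul ?_ _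
  exact gaussPDF_integrable (hP _ _)

lemma pSL_integral (hP : ∀ i1 i2, 0 < P.ν i1 i2) (x : Euc d) : ∫ y, pSL P x y = 1 := by
  simp_rw [pSL_eq]
  have hI : ∀ i1 i2, Integrable fun y => gate2 P x i1 i2 *
      gaussPDF (⟪P.η i1 i2, x⟫ + P.τ i1 i2) (P.ν i1 i2) y :=
    fun i1 i2 => (gaussPDF_integrable (hP _ _)).const_mul _
  rw [integral_finsetSum _ fun i1 _ =>
    (integrable_finsetSum _ fun i2 _ => hI i1 i2).const_mul _]
  simp_rw [integral_const_mul]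
  have : ∀ i1, ∫ y, ∑ i2, gate2 P x i1 i2 *
      gaussPDF (⟪P.η i1 i2, x⟫ + P.τ i1 i2) (P.ν i1 i2) y = 1 := fun i1 => by
    rw [integral_finsetSum _ fun i2 _ => hI i1 i2]
    simp_rw [integral_const_mul, gaussPDF_integral (hP _ _), mul_one]
    exact gate2_sum P x i1
  simp_rw [this, mul_one]
  exact gate1_sum P x

/-- Second moment bound. -/
lemma pSL_sq (hP : ∀ i1 i2, 0 < P.ν i1 i2) (x : Euc d) (M : ℝ)
    (hM : ∀ i1 i2, (⟪P.η i1 i2, x⟫ + P.τ i1 i2) ^ 2 + P.ν i1 i2 ≤ M) :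
    Integrable (fun y => pSL P x y * y ^ 2) ∧ ∫ y, pSL P x y * y ^ 2 ≤ M := by
  simp_rw [pSL_eq, Finset.sum_mul, mul_assoc, Finset.sum_mul, mul_assoc]
  have hI : ∀ i1 i2, Integrable fun y => gate2 P x i1 i2 *
      (gaussPDF (⟪P.η i1 i2, x⟫ + P.τ i1 i2) (P.ν i1 i2) y * y ^ 2) :=
    fun i1 i2 => (gaussPDF_sq (hP _ _)).1.const_mul _
  have hI2 : ∀ i1, Integrable fun y => ∑ i2, gate2 P x i1 i2 *
      (gaussPDF (⟪P.η i1 i2, x⟫ + P.τ i1 i2) (P.ν i1 i2) y * y ^ 2) :=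
    fun i1 => integrable_finsetSum _ fun i2 _ => hI i1 i2
  refine ⟨integrable_finsetSum _ fun i1 _ => (hI2 i1).const_mul _, ?_⟩
  rw [integral_finsetSum _ fun i1 _ => (hI2 i1).const_mul _]
  simp_rw [integral_const_mul]
  have : ∀ i1, ∫ y, ∑ i2, gate2 P x i1 i2 *
      (gaussPDF (⟪P.η i1 i2, x⟫ + P.τ i1 i2) (P.ν i1 i2) y * y ^ 2) ≤ M := fun i1 => by
    rw [integral_finsetSum _ fun i2 _ => hI i1 i2]
    simp_rw [integral_const_mul, (gaussPDF_sq (hP _ _)).2]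
    calc _ ≤ ∑ i2, gate2 P x i1 i2 * M := Finset.sum_le_sum fun i2 _ =>
          mul_le_mul_of_nonneg_left (hM i1 i2) (gate2_pos P x i1 i2).le
      _ = M := by rw [← Finset.sum_mul, gate2_sum, one_mul]
  calc _ ≤ ∑ i1, gate1 P x i1 * M := Finset.sum_le_sum fun i1 _ =>
          mul_le_mul_of_nonneg_left (this i1) (gate1_pos P x i1).le
      _ = M := by rw [← Finset.sum_mul, gate1_sum, one_mul]

end

lemma pSL_measurable {d k1 k2 : ℕ} (P : HMoE d k1 k2) : Measurable fun z : Euc d × ℝ => pSL P z.1 z.2 := by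
  unfold pSL gaussPDF
  fun_prop

/-! ### Hellinger affinity -/

lemma hell_aff {f g : ℝ → ℝ} (hf : ∀ y, 0 ≤ f y) (hg : ∀ y, 0 ≤ g y)
    (hfi : Integrable f) (hgi : Integrable g) (hf1 : ∫ y, f y = 1) (hg1 : ∫ y, g y = 1) :
    Integrable (fun y => Real.sqrt (f y) * Real.sqrt (g y)) ∧
    hellingerDist f g ^ 2 = 1 - ∫ y, Real.sqrt (f y) * Real.sqrt (g y) := by
  have hI : Integrable (fun y => Real.sqrt (f y) * Real.sqrt (g y)) := by
    refine (hfi.add hgi).mono' ?_ ?_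
    · exact (Real.continuous_sqrt.comp_aestronglyMeasurable hfi.1).mul
        (Real.continuous_sqrt.comp_aestronglyMeasurable hgi.1)
    · refine Filter.Eventually.of_forall fun y => ?_
      rw [Real.norm_eq_abs, abs_of_nonneg (by positivity), Pi.add_apply]
      nlinarith [sq_nonneg (Real.sqrt (f y) - Real.sqrt (g y)), Real.sq_sqrt (hf y),
        Real.sq_sqrt (hg y), hf y, hg y]
  refine ⟨hI, ?_⟩
  unfold hellingerDist
  rw [Real.sq_sqrt (mul_nonneg (by norm_num) (integral_nonneg fun y => sq_nonneg _))]
  have h1 : ∀ y, (Real.sqrt (f y) - Real.sqrt (g y)) ^ 2 =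
      f y + g y - 2 * (Real.sqrt (f y) * Real.sqrt (g y)) := fun y => by
    rw [sub_sq, Real.sq_sqrt (hf y), Real.sq_sqrt (hg y)]; ring
  simp_rw [h1]
  have hadd : Integrable fun y => f y + g y := hfi.add hgi
  rw [integral_sub hadd (hI.const_mul 2), integral_add hfi hgi, integral_const_mul,
    hf1, hg1]
  ring

section
variable {d k1 k2 l1 l2 : ℕ} [NeZero k1] [NeZero k2] [NeZero l1] [NeZero l2]

lemma joint_prob (μ : Measure (Euc d)) [IsProbabilityMeasure μ] (Q : HMoE d l1 l2)
    (hQ : ∀ i1 i2, 0 < Q.ν i1 i2) : IsProbabilityMeasure (jointMeasure μ (pSL Q)) := by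
  constructor
  unfold jointMeasure
  rw [withDensity_apply _ MeasurableSet.univ, Measure.restrict_univ,
    lintegral_prod _ (pSL_measurable Q).ennreal_ofReal.aemeasurable]
  have : ∀ x, ∫⁻ y, ENNReal.ofReal (pSL Q x y) = 1 := fun x => by
    rw [← ofReal_integral_eq_lintegral_ofReal (pSL_integrable Q hQ x)
      (Filter.Eventually.of_forall fun y => (pSL_pos Q hQ x y).le), pSL_integral Q hQ x]
    simp
  simp [this]

lemma affinity_le (μ : Measure (Euc d)) [IsProbabilityMeasure μ]
    (P : HMoE d k1 k2) (Q : HMoE d l1 l2)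
    (hP : ∀ i1 i2, 0 < P.ν i1 i2) (hQ : ∀ i1 i2, 0 < Q.ν i1 i2) :
    ∫⁻ z, ENNReal.ofReal (Real.sqrt (pSL P z.1 z.2 / pSL Q z.1 z.2)) ∂(jointMeasure μ (pSL Q)) ≤
      ENNReal.ofReal (Real.exp (-(∫ x, hellingerDist (pSL P x) (pSL Q x) ∂μ) ^ 2)) := by
  have hmP := pSL_measurable P
  have hmQ := pSL_measurable Q
  have hA := fun x => hell_aff (fun y => (pSL_pos P hP x y).le) (fun y => (pSL_pos Q hQ x y).le)
    (pSL_integrable P hP x) (pSL_integrable Q hQ x) (pSL_integral P hP x) (pSL_integral Q hQ x)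
  set H : Euc d → ℝ := fun x => hellingerDist (pSL P x) (pSL Q x) with hH
  have hHn : ∀ x, 0 ≤ H x := fun x => Real.sqrt_nonneg _
  have hHsq : ∀ x, H x ^ 2 = 1 - ∫ y, Real.sqrt (pSL P x y) * Real.sqrt (pSL Q x y) :=
    fun x => (hA x).2
  have hHle : ∀ x, H x ^ 2 ≤ 1 := fun x => by
    rw [hHsq]
    have : 0 ≤ ∫ y, Real.sqrt (pSL P x y) * Real.sqrt (pSL Q x y) :=
      integral_nonneg fun y => by positivity
    linarith
  have hmS : StronglyMeasurable fun z : Euc d × ℝ =>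
      Real.sqrt (pSL P z.1 z.2) * Real.sqrt (pSL Q z.1 z.2) :=
    (hmP.sqrt.mul hmQ.sqrt).stronglyMeasurable
  have hmH2 : Measurable fun x => H x ^ 2 := by
    simp_rw [hHsq]
    exact measurable_const.sub hmS.integral_prod_right.measurable
  have hmH : Measurable H := by
    have : H = fun x => Real.sqrt (H x ^ 2) := by
      funext x; rw [Real.sqrt_sq (hHn x)]
    rw [this]; exact hmH2.sqrt
  have hiH : Integrable H μ := by
    refine Integrable.of_bound hmH.aestronglyMeasurable 1 (Filter.Eventually.of_forall fun x => ?_)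
    rw [Real.norm_eq_abs, abs_of_nonneg (hHn x)]
    nlinarith [hHle x, hHn x]
  have hiH2 : Integrable (fun x => H x ^ 2) μ := by
    refine Integrable.of_bound hmH2.aestronglyMeasurable 1 (Filter.Eventually.of_forall fun x => ?_)
    rw [Real.norm_eq_abs, abs_of_nonneg (sq_nonneg _)]
    exact hHle x
  have hJ : (∫ x, H x ∂μ) ^ 2 ≤ ∫ x, H x ^ 2 ∂μ := by
    set c := ∫ x, H x ∂μ with hc
    have h1 : ∫ x, (2 * c * H x - c ^ 2) ∂μ ≤ ∫ x, H x ^ 2 ∂μ :=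
      integral_mono ((hiH.const_mul _).sub (integrable_const _)) hiH2 fun x => by
        show 2 * c * H x - c ^ 2 ≤ H x ^ 2
        nlinarith [sq_nonneg (H x - c)]
    rw [integral_sub (hiH.const_mul _) (integrable_const _), integral_const_mul, ← hc] at h1
    simp at h1
    nlinarith
  unfold jointMeasure
  have hmd : Measurable fun z : Euc d × ℝ =>
      ENNReal.ofReal (Real.sqrt (pSL P z.1 z.2 / pSL Q z.1 z.2)) :=
    (hmP.div hmQ).sqrt.ennreal_ofReal
  rw [lintegral_withDensity_eq_lintegral_mul _ hmQ.ennreal_ofReal hmd]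
  have h2 : ∀ z : Euc d × ℝ, ((fun z : Euc d × ℝ => ENNReal.ofReal (pSL Q z.1 z.2)) *
      fun z : Euc d × ℝ => ENNReal.ofReal (Real.sqrt (pSL P z.1 z.2 / pSL Q z.1 z.2))) z =
      ENNReal.ofReal (Real.sqrt (pSL P z.1 z.2) * Real.sqrt (pSL Q z.1 z.2)) := fun z => by
    have hq := pSL_pos Q hQ z.1 z.2
    have hp := pSL_pos P hP z.1 z.2
    rw [Pi.mul_apply, ← ENNReal.ofReal_mul hq.le]
    congr 1
    rw [Real.sqrt_div hp.le]
    have hs := Real.sqrt_pos.2 hq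
    field_simp
    rw [Real.sq_sqrt hq.le]
  simp_rw [h2]
  rw [lintegral_prod _ hmS.measurable.ennreal_ofReal.aemeasurable]
  have h3 : ∀ x, ∫⁻ y, ENNReal.ofReal (Real.sqrt (pSL P x y) * Real.sqrt (pSL Q x y)) =
      ENNReal.ofReal (1 - H x ^ 2) := fun x => by
    rw [← ofReal_integral_eq_lintegral_ofReal (hA x).1
      (Filter.Eventually.of_forall fun y => by positivity), hHsq]
    congr 1; ring
  simp only [h3]
  have hi1 : Integrable (fun x => 1 - H x ^ 2) μ := (integrable_const 1).sub hiH2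
  rw [← ofReal_integral_eq_lintegral_ofReal hi1
    (Filter.Eventually.of_forall fun x => sub_nonneg.2 (hHle x)),
    integral_sub (integrable_const 1) hiH2]
  refine ENNReal.ofReal_le_ofReal ?_
  simp only [integral_const, probReal_univ, smul_eq_mul, mul_one]
  have := Real.add_one_le_exp (-(∫ x, H x ∂μ) ^ 2)
  linarith

end

lemma lintegral_pi_prod {α : Type*} [MeasurableSpace α] (ρ : Measure α) [IsProbabilityMeasure ρ]
    (n : ℕ) (f : α → ENNReal) (hf : Measurable f) :
    ∫⁻ s, ∏ i, f (s i) ∂(Measure.pi fun _ : Fin n => ρ) = (∫⁻ z, f z ∂ρ) ^ n := by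
  have h := ProbabilityTheory.lintegral_prod_eq_prod_lintegral_of_indepFun Finset.univ
    (fun (i : Fin n) (s : Fin n → α) => f (s i))
    (ProbabilityTheory.iIndepFun_pi (μ := fun _ : Fin n => ρ) (X := fun _ => f)
      fun _ => hf.aemeasurable) (fun i => hf.comp (measurable_pi_apply i))
  rw [h]
  have h2 : ∀ i : Fin n, ∫⁻ s, f (s i) ∂(Measure.pi fun _ : Fin n => ρ) = ∫⁻ z, f z ∂ρ := fun i =>
    (measurePreserving_eval (fun _ : Fin n => ρ) i).lintegral_comp hf
  simp [h2]

lemma lintegral_pi_sum {α : Type*} [MeasurableSpace α] (ρ : Measure α) [IsProbabilityMeasure ρ]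
    (n : ℕ) (f : α → ENNReal) (hf : Measurable f) :
    ∫⁻ s, ∑ i, f (s i) ∂(Measure.pi fun _ : Fin n => ρ) = n * ∫⁻ z, f z ∂ρ := by
  have hm : ∀ i : Fin n, Measurable fun s : Fin n → α => f (s i) := fun i =>
    hf.comp (measurable_pi_apply i)
  rw [lintegral_finsetSum _ fun i _ => hm i]
  have h2 : ∀ i : Fin n, ∫⁻ s, f (s i) ∂(Measure.pi fun _ : Fin n => ρ) = ∫⁻ z, f z ∂ρ := fun i =>
    (measurePreserving_eval (fun _ : Fin n => ρ) i).lintegral_comp hf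
  simp [h2]

/-! ### Likelihood ratios of nearby parameters -/

lemma softmax_ratio {k : ℕ} [NeZero k] (f g : Fin k → ℝ) (t : ℝ) (h : ∀ j, |f j - g j| ≤ t)
    (i : Fin k) :
    Real.exp (f i) / ∑ j, Real.exp (f j) ≤
      Real.exp (2 * t) * (Real.exp (g i) / ∑ j, Real.exp (g j)) := by
  have h1 : Real.exp (f i) ≤ Real.exp t * Real.exp (g i) := by
    rw [← Real.exp_add, Real.exp_le_exp]
    linarith [(abs_le.1 (h i)).2]
  have h2 : ∑ j, Real.exp (g j) ≤ Real.exp t * ∑ j, Real.exp (f j) := by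
    rw [Finset.mul_sum]
    refine Finset.sum_le_sum fun j _ => ?_
    rw [← Real.exp_add, Real.exp_le_exp]
    linarith [(abs_le.1 (h j)).1]
  have hf := sumexp_pos f
  have hg := sumexp_pos g
  rw [← mul_div_assoc, div_le_div_iff₀ hf hg]
  calc Real.exp (f i) * ∑ j, Real.exp (g j)
      ≤ (Real.exp t * Real.exp (g i)) * (Real.exp t * ∑ j, Real.exp (f j)) := by gcongr
    _ = _ := by rw [two_mul, Real.exp_add]; ring

lemma gauss_ratio {v0 B ε T m m' v v' y : ℝ} (hv0 : 0 < v0) (hB : 0 ≤ B)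
    (hT : 1 ≤ T) (hv : v0 ≤ v) (hv' : v0 ≤ v') (hvv : |v' - v| ≤ ε) (hmm : |m' - m| ≤ ε * T)
    (hm : |m| ≤ B * T) (hm' : |m'| ≤ B * T) (hy : |y| ≤ T) :
    gaussPDF m' v' y ≤
      Real.exp ((1 / v0 + (1 + B) / v0 + (1 + B) ^ 2 / v0 ^ 2) * ε * T ^ 2) * gaussPDF m v y := by
  have hε : 0 ≤ ε := (abs_nonneg _).trans hvv
  have hvp : 0 < v := hv0.trans_le hv
  have hvp' : 0 < v' := hv0.trans_le hv'
  have hpi := Real.pi_pos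
  unfold gaussPDF
  -- normalizing constants
  have hN : (Real.sqrt (2 * Real.pi * v'))⁻¹ ≤
      Real.exp (1 / v0 * ε * T ^ 2) * (Real.sqrt (2 * Real.pi * v))⁻¹ := by
    have h1 : v ≤ v' * Real.exp (ε / v0) := by
      have h2 := Real.add_one_le_exp (ε / v0)
      have h3 : v ≤ v' + ε := by linarith [(abs_le.1 hvv).1]
      have h4 : ε ≤ v' * (ε / v0) := by
        rw [mul_div_assoc', le_div_iff₀ hv0]; nlinarith
      nlinarith
    have h5 : Real.sqrt (2 * Real.pi * v) ≤
        Real.exp (ε / v0) * Real.sqrt (2 * Real.pi * v') := by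
      have he : 1 ≤ Real.exp (ε / v0) := Real.one_le_exp (by positivity)
      refine Real.sqrt_le_iff.2 ⟨by positivity, ?_⟩
      rw [mul_pow, Real.sq_sqrt (by positivity)]
      calc 2 * Real.pi * v ≤ 2 * Real.pi * (v' * Real.exp (ε / v0)) := by gcongr
        _ = Real.exp (ε / v0) ^ 1 * (2 * Real.pi * v') := by ring
        _ ≤ Real.exp (ε / v0) ^ 2 * (2 * Real.pi * v') := by gcongr; norm_num
    have hs : 0 < Real.sqrt (2 * Real.pi * v) := Real.sqrt_pos.2 (by positivity)
    have hs' : 0 < Real.sqrt (2 * Real.pi * v') := Real.sqrt_pos.2 (by positivity)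
    have h6 : (Real.sqrt (2 * Real.pi * v'))⁻¹ ≤
        Real.exp (ε / v0) * (Real.sqrt (2 * Real.pi * v))⁻¹ := by
      rw [← div_eq_mul_inv, le_div_iff₀ hs, inv_mul_le_iff₀ hs']
      linarith
    refine h6.trans ?_
    gcongr
    have : 0 ≤ ε / v0 := by positivity
    have hT2 : 1 ≤ T ^ 2 := one_le_pow₀ hT
    calc ε / v0 = (ε / v0) * 1 := by ring
      _ ≤ (ε / v0) * T ^ 2 := by gcongr
      _ = _ := by ring
  -- exponents
  have hE : -(y - m') ^ 2 / (2 * v') ≤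
      ((1 + B) / v0 + (1 + B) ^ 2 / v0 ^ 2) * ε * T ^ 2 + -(y - m) ^ 2 / (2 * v) := by
    have h1 : (y - m) ^ 2 - (y - m') ^ 2 ≤ 2 * (1 + B) * ε * T ^ 2 := by
      have e1 : (y - m) ^ 2 - (y - m') ^ 2 = (m' - m) * (2 * y - m - m') := by ring
      have e2 : |2 * y - m - m'| ≤ 2 * (1 + B) * T := by
        have := abs_le.1 hy; have := abs_le.1 hm; have := abs_le.1 hm'
        rw [abs_le]; constructor <;> linarith
      rw [e1]
      calc _ ≤ |(m' - m) * (2 * y - m - m')| := le_abs_self _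
        _ = |m' - m| * |2 * y - m - m'| := abs_mul _ _
        _ ≤ (ε * T) * (2 * (1 + B) * T) := by gcongr
        _ = _ := by ring
    have h2 : (y - m') ^ 2 ≤ ((1 + B) * T) ^ 2 := by
      have := abs_le.1 hy; have := abs_le.1 hm'
      refine sq_le_sq' ?_ ?_ <;> linarith
    have h3 : 1 / (2 * v) - 1 / (2 * v') ≤ ε / v0 ^ 2 := by
      rw [div_sub_div _ _ (by positivity) (by positivity), div_le_div_iff₀ (by positivity)
        (by positivity)]
      have h4 : v' - v ≤ ε := (abs_le.1 hvv).2
      have h5 : v0 ^ 2 ≤ v * v' := by nlinarith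
      have h6 : (v' - v) * v0 ^ 2 ≤ ε * (v * v') := by
        calc (v' - v) * v0 ^ 2 ≤ ε * v0 ^ 2 := by gcongr
          _ ≤ _ := by gcongr
      nlinarith [mul_nonneg hε (mul_pos hvp hvp').le]
    have h7 : ((y - m) ^ 2 - (y - m') ^ 2) / (2 * v) ≤ (1 + B) / v0 * ε * T ^ 2 := by
      calc _ ≤ (2 * (1 + B) * ε * T ^ 2) / (2 * v) := by gcongr
        _ ≤ (2 * (1 + B) * ε * T ^ 2) / (2 * v0) := by gcongr
        _ = _ := by field_simp
    have h8 : (y - m') ^ 2 * (1 / (2 * v) - 1 / (2 * v')) ≤ (1 + B) ^ 2 / v0 ^ 2 * ε * T ^ 2 := by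
      calc _ ≤ (y - m') ^ 2 * (ε / v0 ^ 2) := by gcongr
        _ ≤ ((1 + B) * T) ^ 2 * (ε / v0 ^ 2) := by gcongr
        _ = _ := by ring
    have e3 : -(y - m') ^ 2 / (2 * v') - -(y - m) ^ 2 / (2 * v) =
        ((y - m) ^ 2 - (y - m') ^ 2) / (2 * v) +
          (y - m') ^ 2 * (1 / (2 * v) - 1 / (2 * v')) := by ring
    have e4 : ((1 + B) / v0 + (1 + B) ^ 2 / v0 ^ 2) * ε * T ^ 2 =
      (1 + B) / v0 * ε * T ^ 2 + (1 + B) ^ 2 / v0 ^ 2 * ε * T ^ 2 := by ring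
    linarith
  calc _ ≤ (Real.exp (1 / v0 * ε * T ^ 2) * (Real.sqrt (2 * Real.pi * v))⁻¹) *
        Real.exp (((1 + B) / v0 + (1 + B) ^ 2 / v0 ^ 2) * ε * T ^ 2 +
          -(y - m) ^ 2 / (2 * v)) := by gcongr
    _ = _ := by
      rw [Real.exp_add, show (1 / v0 + (1 + B) / v0 + (1 + B) ^ 2 / v0 ^ 2) * ε * T ^ 2 =
        1 / v0 * ε * T ^ 2 + ((1 + B) / v0 + (1 + B) ^ 2 / v0 ^ 2) * ε * T ^ 2 by ring,
        Real.exp_add]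
      ring

/-- Parameter tuple of expert `(i1, i2)`. -/
def tup {d k1 k2 : ℕ} (P : HMoE d k1 k2) (i1 : Fin k1) (i2 : Fin k2) :
    ℝ × Euc d × ℝ × Euc d × Euc d × ℝ × ℝ :=
  (P.b i1, P.a i1, P.β i1 i2, P.ω i1 i2, P.η i1 i2, P.τ i1 i2, P.ν i1 i2)

/-- Growth function. -/
def Wf {d : ℕ} (z : Euc d × ℝ) : ℝ := (1 + ‖z.1‖ + |z.2|) ^ 2

lemma tup_norm_le {d : ℕ} {ε : ℝ} {b β τ ν : ℝ} {a ω η : Euc d}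
    (h : ‖((b, a, β, ω, η, τ, ν) : ℝ × Euc d × ℝ × Euc d × Euc d × ℝ × ℝ)‖ ≤ ε) :
    |b| ≤ ε ∧ ‖a‖ ≤ ε ∧ |β| ≤ ε ∧ ‖ω‖ ≤ ε ∧ ‖η‖ ≤ ε ∧ |τ| ≤ ε ∧ |ν| ≤ ε := by
  simpa only [Prod.norm_mk, sup_le_iff, Real.norm_eq_abs] using h

lemma pSL_ratio {d k1 k2 : ℕ} [NeZero k1] [NeZero k2]
    (Θ : Set (ℝ × Euc d × ℝ × Euc d × Euc d × ℝ × ℝ)) {v0 B ε : ℝ} (hv0 : 0 < v0) (hB : 0 ≤ B)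
    (hΘv : ∀ θ ∈ Θ, v0 ≤ θ.2.2.2.2.2.2) (hΘB : ∀ θ ∈ Θ, ‖θ‖ ≤ B)
    (P Q : HMoE d k1 k2) (hP : inParamSpace Θ P) (hQ : inParamSpace Θ Q)
    (hPQ : ∀ i1 i2, ‖tup P i1 i2 - tup Q i1 i2‖ ≤ ε) (z : Euc d × ℝ) :
    pSL P z.1 z.2 ≤
      Real.exp ((6 + (1 / v0 + (1 + B) / v0 + (1 + B) ^ 2 / v0 ^ 2)) * ε * Wf z) *
        pSL Q z.1 z.2 := by
  obtain ⟨x, y⟩ := z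
  have hε : 0 ≤ ε := (norm_nonneg _).trans (hPQ 0 0)
  unfold Wf
  set T := 1 + ‖x‖ + |y| with hTdef
  have hx := norm_nonneg x
  have hy := abs_nonneg y
  have hT : 1 ≤ T := by linarith
  have hd := fun i1 i2 => tup_norm_le (by simpa only [tup, Prod.mk_sub_mk] using hPQ i1 i2)
  have hinner : ∀ (u : Euc d) (s c : ℝ), ‖u‖ ≤ c → |s| ≤ c → |⟪u, x⟫ + s| ≤ c * T := by
    intro u s c hu hs
    have hc : 0 ≤ c := (norm_nonneg _).trans hu
    calc |⟪u, x⟫ + s| ≤ |⟪u, x⟫| + |s| := abs_add_le _ _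
      _ ≤ ‖u‖ * ‖x‖ + |s| := by gcongr; exact abs_real_inner_le_norm u x
      _ ≤ c * ‖x‖ + c := by gcongr
      _ ≤ c * T := by rw [hTdef]; nlinarith
  have hεT : ε * T ≤ ε * T ^ 2 := by
    gcongr; nlinarith
  have hεT1 : ε ≤ ε * T ^ 2 := by nlinarith
  set L := 1 / v0 + (1 + B) / v0 + (1 + B) ^ 2 / v0 ^ 2
  have hg1 : ∀ i1, gate1 P x i1 ≤ Real.exp (2 * (ε * T ^ 2)) * gate1 Q x i1 := fun i1 => by
    refine softmax_ratio (fun j => ⟪P.a j, x⟫ + P.b j) (fun j => ⟪Q.a j, x⟫ + Q.b j) _ ?_ i1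
    intro j
    obtain ⟨hb, ha, -⟩ := hd j 0
    have := hinner _ _ _ ha hb
    rw [inner_sub_left] at this
    refine le_trans (le_of_eq ?_) (this.trans hεT)
    congr 1; ring
  have hg2 : ∀ i1 i2, gate2 P x i1 i2 ≤ Real.exp (2 * (2 * (ε * T ^ 2))) * gate2 Q x i1 i2 :=
    fun i1 i2 => by
    refine softmax_ratio (fun j => -‖P.ω i1 j - x‖ + P.β i1 j)
      (fun j => -‖Q.ω i1 j - x‖ + Q.β i1 j) _ ?_ i2
    intro j
    obtain ⟨-, -, hβ, hω, -⟩ := hd i1 j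
    have h1 := abs_norm_sub_norm_le (P.ω i1 j - x) (Q.ω i1 j - x)
    rw [sub_sub_sub_cancel_right] at h1
    have h2 := abs_le.1 (h1.trans hω)
    have h3 := abs_le.1 hβ
    rw [abs_le]
    constructor <;> linarith
  have hg3 : ∀ i1 i2, gaussPDF (⟪P.η i1 i2, x⟫ + P.τ i1 i2) (P.ν i1 i2) y ≤
      Real.exp (L * ε * T ^ 2) *
        gaussPDF (⟪Q.η i1 i2, x⟫ + Q.τ i1 i2) (Q.ν i1 i2) y := fun i1 i2 => by
    obtain ⟨-, -, -, -, hη, hτ, hν⟩ := hd i1 i2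
    obtain ⟨-, -, -, -, hη1, hτ1, -⟩ := tup_norm_le (hΘB _ (hP i1 i2))
    obtain ⟨-, -, -, -, hη2, hτ2, -⟩ := tup_norm_le (hΘB _ (hQ i1 i2))
    refine gauss_ratio hv0 hB hT (hΘv _ (hQ i1 i2)) (hΘv _ (hP i1 i2)) hν ?_
      (hinner _ _ _ hη2 hτ2) (hinner _ _ _ hη1 hτ1) (by linarith)
    have := hinner _ _ _ hη hτ
    rw [inner_sub_left] at this
    refine le_trans (le_of_eq ?_) this
    congr 1; ring
  simp only [pSL_eq]
  have hνQ : ∀ i1 i2, 0 < Q.ν i1 i2 := fun i1 i2 => hv0.trans_le (hΘv _ (hQ i1 i2))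
  have hνP : ∀ i1 i2, 0 < P.ν i1 i2 := fun i1 i2 => hv0.trans_le (hΘv _ (hP i1 i2))
  rw [Finset.mul_sum]
  refine Finset.sum_le_sum fun i1 _ => ?_
  rw [Finset.mul_sum, Finset.mul_sum, Finset.mul_sum]
  refine Finset.sum_le_sum fun i2 _ => ?_
  have p1 := gate1_pos P x i1
  have p2 := gate2_pos P x i1 i2
  have p3 := gaussPDF_pos (m := ⟪P.η i1 i2, x⟫ + P.τ i1 i2) (hνP i1 i2) y
  have q1 := gate1_pos Q x i1
  have q2 := gate2_pos Q x i1 i2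
  calc _ ≤ (Real.exp (2 * (ε * T ^ 2)) * gate1 Q x i1) *
        ((Real.exp (2 * (2 * (ε * T ^ 2))) * gate2 Q x i1 i2) * (Real.exp (L * ε * T ^ 2) *
          gaussPDF (⟪Q.η i1 i2, x⟫ + Q.τ i1 i2) (Q.ν i1 i2) y)) :=
        mul_le_mul (hg1 i1) (mul_le_mul (hg2 i1 i2) (hg3 i1 i2) p3.le (by positivity))
          (by positivity) (by positivity)
    _ = _ := by
      rw [show (6 + L) * ε * T ^ 2 = 2 * (ε * T ^ 2) + (2 * (2 * (ε * T ^ 2)) + L * ε * T ^ 2) by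
        ring, Real.exp_add, Real.exp_add]
      ring

/-! ### Covering of the candidate class -/

lemma cand_cover {d k1 : ℕ} [NeZero k1] (k2 : ℕ)
    (Θ : Set (ℝ × Euc d × ℝ × Euc d × Euc d × ℝ × ℝ)) {v0 B : ℝ} (hv0 : 0 < v0) (hB : 0 ≤ B)
    (hΘv : ∀ θ ∈ Θ, v0 ≤ θ.2.2.2.2.2.2) (hΘB : ∀ θ ∈ Θ, ‖θ‖ ≤ B) :
    ∃ (A : ℝ) (D : ℕ), 0 ≤ A ∧ ∀ n : ℕ, 1 ≤ n → ∀ Bd ⊆ candClass d k1 k2 Θ,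
      ∃ T : Finset (Candidate d k1), (∀ t ∈ T, t ∈ Bd) ∧ (T.card : ℝ) ≤ A * (n : ℝ) ^ D ∧
        ∀ c ∈ Bd, ∃ t ∈ T, ∀ z : Euc d × ℝ, pSL c.2 z.1 z.2 ≤
          Real.exp ((6 + (1 / v0 + (1 + B) / v0 + (1 + B) ^ 2 / v0 ^ 2)) * (1 / (n : ℝ) ^ 2) *
            Wf z) * pSL t.2 z.1 z.2 := by
  classical
  let S : (k : ℕ) → Set (Fin k1 → Fin k → ℝ × Euc d × ℝ × Euc d × Euc d × ℝ × ℝ) :=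
    fun k => {w | ∀ i1 i2, ‖w i1 i2‖ ≤ B}
  have hS : ∀ k, Bornology.IsBounded (S k) := fun k => by
    refine isBounded_iff_forall_norm_le.2 ⟨B, fun w hw => ?_⟩
    exact (pi_norm_le_iff_of_nonneg hB).2 fun i1 => (pi_norm_le_iff_of_nonneg hB).2 fun i2 => hw i1 i2
  choose A D hA hcov using fun k => exists_cover (S k) (hS k)
  refine ⟨∑ k ∈ Finset.Icc 1 k2, A k, ∑ k ∈ Finset.Icc 1 k2, D k,
    Finset.sum_nonneg fun k _ => hA k, ?_⟩
  intro n hn Bd hBd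
  have hU : ∀ k, ∃ U : Finset (Candidate d k1), (∀ t ∈ U, t ∈ Bd) ∧
      (U.card : ℝ) ≤ A k * (n : ℝ) ^ D k ∧
      ∀ P : HMoE d k1 k, (⟨k, P⟩ : Candidate d k1) ∈ Bd → ∃ t ∈ U, ∀ z : Euc d × ℝ,
        pSL P z.1 z.2 ≤
          Real.exp ((6 + (1 / v0 + (1 + B) / v0 + (1 + B) ^ 2 / v0 ^ 2)) * (1 / (n : ℝ) ^ 2) *
            Wf z) * pSL t.2 z.1 z.2 := by
    intro k
    obtain ⟨T, hTB, hTc, hT⟩ := hcov k n hn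
      {w | ∃ P : HMoE d k1 k, (⟨k, P⟩ : Candidate d k1) ∈ Bd ∧ tup P = w} (by
        rintro w ⟨P, hP, rfl⟩ i1 i2
        exact hΘB _ ((hBd hP).2.2 i1 i2))
    choose c hcB hct using fun t : T => hTB t t.2
    let g : T → Candidate d k1 := fun t => ⟨k, c t⟩
    refine ⟨Finset.univ.image g, ?_, ?_, ?_⟩
    · intro t ht
      obtain ⟨j, -, rfl⟩ := Finset.mem_image.1 ht
      exact hcB j
    · refine le_trans ?_ hTc
      have := Finset.card_image_le (s := (Finset.univ : Finset T))
        (f := g)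
      simp only [Finset.card_univ, Fintype.card_coe] at this
      exact_mod_cast this
    · intro P hP
      obtain ⟨t, ht, htn⟩ := hT (tup P) ⟨P, hP, rfl⟩
      refine ⟨g ⟨t, ht⟩, Finset.mem_image_of_mem _ (Finset.mem_univ _), ?_⟩
      have hk : NeZero k := ⟨by have := (hBd hP).1; simp only at this; omega⟩
      refine pSL_ratio Θ hv0 hB hΘv hΘB P (c ⟨t, ht⟩) (hBd hP).2.2 (hBd (hcB ⟨t, ht⟩)).2.2 ?_
      intro i1 i2
      have hct' : tup (c ⟨t, ht⟩) = t := hct ⟨t, ht⟩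
      rw [← hct'] at htn
      exact (norm_le_pi_norm _ i2).trans ((norm_le_pi_norm _ i1).trans htn)
  choose U hUB hUc hUr using hU
  refine ⟨(Finset.Icc 1 k2).biUnion U, ?_, ?_, ?_⟩
  · intro t ht
    obtain ⟨k, -, hk⟩ := Finset.mem_biUnion.1 ht
    exact hUB k t hk
  · have h1 : (((Finset.Icc 1 k2).biUnion U).card : ℝ) ≤ ∑ k ∈ Finset.Icc 1 k2, ((U k).card : ℝ) := by
      exact_mod_cast Finset.card_biUnion_le
    refine h1.trans ?_
    rw [Finset.sum_mul]
    refine Finset.sum_le_sum fun k hk => (hUc k).trans ?_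
    refine mul_le_mul_of_nonneg_left ?_ (hA k)
    refine pow_le_pow_right₀ (by exact_mod_cast hn) ?_
    exact Finset.single_le_sum (f := D) (fun _ _ => Nat.zero_le _) hk
  · rintro ⟨k, P⟩ hc
    obtain ⟨t, ht, h⟩ := hUr k P hc
    refine ⟨t, Finset.mem_biUnion.2 ⟨k, ?_, ht⟩, h⟩
    exact Finset.mem_Icc.2 ⟨(hBd hc).1, (hBd hc).2.1⟩

lemma Wf_measurable {d : ℕ} : Measurable (Wf (d := d)) := by
  have h : Wf (d := d) = fun z : Euc d × ℝ => (1 + ‖z.1‖ + |z.2|) ^ 2 := rfl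
  rw [h]
  exact (by fun_prop : Continuous fun z : Euc d × ℝ => (1 + ‖z.1‖ + |z.2|) ^ 2).measurable

lemma moment_bound {d l1 l2 : ℕ} [NeZero l1] [NeZero l2] (μ : Measure (Euc d))
    [IsProbabilityMeasure μ] {R B : ℝ} (hR : ∀ᵐ x ∂μ, ‖x‖ ≤ R) (hB : 0 ≤ B)
    (Q : HMoE d l1 l2) (hQ : ∀ i1 i2, 0 < Q.ν i1 i2) (hQB : ∀ i1 i2, ‖tup Q i1 i2‖ ≤ B) :
    ∃ M : ℝ, 0 ≤ M ∧ ∫⁻ z, ENNReal.ofReal (Wf z) ∂(jointMeasure μ (pSL Q)) ≤ ENNReal.ofReal M := by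
  have hmQ := pSL_measurable Q
  refine ⟨2 * (1 + R) ^ 2 + 2 * ((B * (1 + R)) ^ 2 + B), by positivity, ?_⟩
  unfold jointMeasure
  rw [lintegral_withDensity_eq_lintegral_mul _ hmQ.ennreal_ofReal Wf_measurable.ennreal_ofReal,
    lintegral_prod _ (hmQ.ennreal_ofReal.mul Wf_measurable.ennreal_ofReal).aemeasurable]
  have key : ∀ᵐ x ∂μ, ∫⁻ y, ENNReal.ofReal (pSL Q x y) * ENNReal.ofReal (Wf (x, y)) ≤
      ENNReal.ofReal (2 * (1 + R) ^ 2 + 2 * ((B * (1 + R)) ^ 2 + B)) := by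
    filter_upwards [hR] with x hx
    have hx0 := norm_nonneg x
    have hsq := pSL_sq Q hQ x ((B * (1 + R)) ^ 2 + B) (fun i1 i2 => by
      obtain ⟨-, -, -, -, hη, hτ, hν⟩ := tup_norm_le (hQB i1 i2)
      have h1 : |⟪Q.η i1 i2, x⟫ + Q.τ i1 i2| ≤ B * (1 + R) := by
        calc _ ≤ |⟪Q.η i1 i2, x⟫| + |Q.τ i1 i2| := abs_add_le _ _
          _ ≤ ‖Q.η i1 i2‖ * ‖x‖ + |Q.τ i1 i2| := by gcongr; exact abs_real_inner_le_norm _ _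
          _ ≤ B * R + B := by gcongr
          _ = _ := by ring
      have h2 := abs_le.1 h1
      exact add_le_add (sq_le_sq' h2.1 h2.2) ((le_abs_self _).trans hν))
    have hi := pSL_integrable Q hQ x
    have hI : Integrable fun y => 2 * (1 + R) ^ 2 * pSL Q x y + 2 * (pSL Q x y * y ^ 2) :=
      (hi.const_mul _).add (hsq.1.const_mul _)
    calc _ ≤ ∫⁻ y, ENNReal.ofReal (2 * (1 + R) ^ 2 * pSL Q x y + 2 * (pSL Q x y * y ^ 2)) := by
          refine lintegral_mono fun y => ?_
          have hp := pSL_pos Q hQ x y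
          rw [← ENNReal.ofReal_mul hp.le]
          refine ENNReal.ofReal_le_ofReal ?_
          have hW : Wf (x, y) ≤ 2 * (1 + R) ^ 2 + 2 * y ^ 2 := by
            show (1 + ‖x‖ + |y|) ^ 2 ≤ _
            have h3 : (1 + ‖x‖) ^ 2 ≤ (1 + R) ^ 2 := by gcongr
            nlinarith [sq_nonneg (1 + ‖x‖ - |y|), sq_abs y]
          calc pSL Q x y * Wf (x, y) ≤ pSL Q x y * (2 * (1 + R) ^ 2 + 2 * y ^ 2) := by gcongr
            _ = _ := by ring
      _ = ENNReal.ofReal (∫ y, (2 * (1 + R) ^ 2 * pSL Q x y + 2 * (pSL Q x y * y ^ 2))) := by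
          rw [ofReal_integral_eq_lintegral_ofReal hI]
          refine Filter.Eventually.of_forall fun y => ?_
          have hp := pSL_pos Q hQ x y
          show 0 ≤ _
          positivity
      _ ≤ _ := by
          refine ENNReal.ofReal_le_ofReal ?_
          rw [integral_add (hi.const_mul _) (hsq.1.const_mul _), integral_const_mul,
            integral_const_mul, pSL_integral Q hQ x]
          linarith [hsq.2]
  calc _ ≤ ∫⁻ _, ENNReal.ofReal (2 * (1 + R) ^ 2 + 2 * ((B * (1 + R)) ^ 2 + B)) ∂μ :=
        lintegral_mono_ae key
    _ = _ := by simp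

/-- Density estimation rate for the MLE in the Softmax–Laplace Gaussian HMoE:
under (A.1)–(A.4), any maximum likelihood estimator `Ĝₙ` over `𝒢_{k₁*,k₂}(Θ)` (with
`k₂ > k₂*`) satisfies
`ℙ( E_X[h(p^SL_{Ĝₙ}(·|X), p^SL_{G*}(·|X))] > C₁ √(log n / n) ) ≤ C₂ exp(−c₁ log n)`
for all `n ≥ 2`, for universal constants `C₁, c₁, C₂ > 0`. -/
theorem mle_density_rate_SL {d K1 K2 : ℕ} (k2 : ℕ)
    (Θ : Set (ℝ × Euc d × ℝ × Euc d × Euc d × ℝ × ℝ))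
    -- (A.1): compact parameter space (with positive variances), bounded input support
    (hΘ : IsCompact Θ)
    (hΘν : ∀ θ ∈ Θ, 0 < θ.2.2.2.2.2.2)
    (μ : Measure (Euc d)) [IsProbabilityMeasure μ]
    (hμ : ∃ s : Set (Euc d), Bornology.IsBounded s ∧ μ sᶜ = 0)
    -- true mixing measure, with k₁* = K1 + 1 groups and k₂* = K2 + 1 experts per group
    (Gs : HMoE d (K1 + 1) (K2 + 1))
    (hGs : inParamSpace Θ Gs)
    (hk2 : K2 + 1 < k2)
    -- (A.2): normalization for identifiability
    (hA2a : Gs.a (Fin.last K1) = 0) (hA2b : Gs.b (Fin.last K1) = 0)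
    (hA2ω : ∀ i1, Gs.ω i1 (Fin.last K2) = 0) (hA2β : ∀ i1, Gs.β i1 (Fin.last K2) = 0)
    -- (A.3): distinct expert parameters within each group
    (hA3 : ∀ i1, Function.Injective fun i2 => (Gs.η i1 i2, Gs.τ i1 i2, Gs.ν i1 i2))
    -- (A.4): input-dependent gating
    (hA4a : ∃ i1, Gs.a i1 ≠ 0) (hA4ω : ∃ i1 i2, Gs.ω i1 i2 ≠ 0)
    -- the estimator: a maximizer of the empirical log-likelihood over 𝒢_{k₁*,k₂}(Θ)
    (Ghat : (n : ℕ) → (Fin n → Euc d × ℝ) → Candidate d (K1 + 1))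
    (hMLE : ∀ (n : ℕ) (s : Fin n → Euc d × ℝ),
      Ghat n s ∈ candClass d (K1 + 1) k2 Θ ∧
      ∀ G ∈ candClass d (K1 + 1) k2 Θ,
        (1 / (n : ℝ)) * ∑ i, Real.log (pSL G.2 (s i).1 (s i).2) ≤
          (1 / (n : ℝ)) * ∑ i, Real.log (pSL (Ghat n s).2 (s i).1 (s i).2)) :
    ∃ C1 c1 C2 : ℝ, 0 < C1 ∧ 0 < c1 ∧ 0 < C2 ∧
      ∀ n : ℕ, 2 ≤ n →
        (Measure.pi fun _ : Fin n => jointMeasure μ (pSL Gs))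
            {s | C1 * Real.sqrt (Real.log n / n) <
              ∫ x, hellingerDist (pSL (Ghat n s).2 x) (pSL Gs x) ∂μ} ≤
          ENNReal.ofReal (C2 * Real.exp (-(c1 * Real.log n))) := by
  classical
  -- constants
  have hne : Θ.Nonempty := ⟨_, hGs 0 0⟩
  obtain ⟨θ0, hθ0, hmin⟩ := hΘ.exists_isMinOn hne
    (f := fun θ => θ.2.2.2.2.2.2) (by fun_prop)
  obtain ⟨v0, hv0, hΘv⟩ : ∃ v0 : ℝ, 0 < v0 ∧ ∀ θ ∈ Θ, v0 ≤ θ.2.2.2.2.2.2 :=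
    ⟨_, hΘν θ0 hθ0, fun θ hθ => hmin hθ⟩
  obtain ⟨B, hΘB⟩ := hΘ.isBounded.exists_norm_le
  have hB : 0 ≤ B := (norm_nonneg _).trans (hΘB θ0 hθ0)
  obtain ⟨A, D, hA, hcov⟩ := cand_cover (k1 := K1 + 1) k2 Θ hv0 hB hΘv hΘB
  set L := 6 + (1 / v0 + (1 + B) / v0 + (1 + B) ^ 2 / v0 ^ 2) with hL
  have hL0 : 0 ≤ L := by positivity
  have hνs : ∀ i1 i2, 0 < Gs.ν i1 i2 := fun i1 i2 => hΘν _ (hGs i1 i2)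
  obtain ⟨R, hR⟩ : ∃ R : ℝ, ∀ᵐ x ∂μ, ‖x‖ ≤ R := by
    obtain ⟨s, hs, hs0⟩ := hμ
    obtain ⟨R, hR⟩ := hs.exists_norm_le
    refine ⟨R, ?_⟩
    have : ∀ᵐ x ∂μ, x ∈ s := hs0
    filter_upwards [this] with x hx using hR x hx
  obtain ⟨M, hM, hmom⟩ := moment_bound μ hR hB Gs hνs fun i1 i2 => hΘB _ (hGs i1 i2)
  have hprob := joint_prob μ Gs hνs
  set ρ := jointMeasure μ (pSL Gs) with hρ
  refine ⟨Real.sqrt (D + 1), 1, A * Real.exp L + M + 1, by positivity, one_pos, by positivity, ?_⟩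
  intro n hn
  have hn0 : (0 : ℝ) < n := by exact_mod_cast (by omega : 0 < n)
  have hlog : 0 ≤ Real.log n := Real.log_nonneg (by exact_mod_cast (by omega : 1 ≤ n))
  set δ := Real.sqrt (D + 1) * Real.sqrt (Real.log n / n) with hδ
  have hδ0 : 0 ≤ δ := by positivity
  have hδ2 : n * δ ^ 2 = (D + 1) * Real.log n := by
    rw [hδ, mul_pow, Real.sq_sqrt (by positivity), Real.sq_sqrt (by positivity)]
    field_simp
  obtain ⟨T, hTB, hTc, hT⟩ := hcov n (by omega)
    {c | c ∈ candClass d (K1 + 1) k2 Θ ∧ δ < ∫ x, hellingerDist (pSL c.2 x) (pSL Gs x) ∂μ}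
    (fun c hc => hc.1)
  set F : Candidate d (K1 + 1) → Euc d × ℝ → ENNReal := fun t z =>
    ENNReal.ofReal (Real.sqrt (pSL t.2 z.1 z.2 / pSL Gs z.1 z.2)) with hF
  have hFm : ∀ t, Measurable (F t) := fun t =>
    ((pSL_measurable t.2).div (pSL_measurable Gs)).sqrt.ennreal_ofReal
  set E0 : Set (Fin n → Euc d × ℝ) :=
    {s | ENNReal.ofReal ((n : ℝ) ^ 2) ≤ ∑ i, ENNReal.ofReal (Wf (s i))} with hE0
  set E1 : Candidate d (K1 + 1) → Set (Fin n → Euc d × ℝ) := fun t =>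
    {s | 1 ≤ ENNReal.ofReal (Real.exp L) * ∏ i, F t (s i)} with hE1
  have hposC : ∀ c ∈ candClass d (K1 + 1) k2 Θ, ∀ z : Euc d × ℝ, 0 < pSL c.2 z.1 z.2 := by
    rintro ⟨k, P⟩ hc z
    have hk : NeZero k := ⟨by have := hc.1; simp only at this; omega⟩
    exact pSL_pos P (fun i1 i2 => hΘν _ (hc.2.2 i1 i2)) _ _
  have hpos0 : ∀ z : Euc d × ℝ, 0 < pSL Gs z.1 z.2 := fun z => pSL_pos Gs hνs _ _
  have hsub : {s | δ < ∫ x, hellingerDist (pSL (Ghat n s).2 x) (pSL Gs x) ∂μ} ⊆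
      E0 ∪ ⋃ t ∈ T, E1 t := by
    intro s hs
    by_cases hsE : s ∈ E0
    · exact Or.inl hsE
    refine Or.inr ?_
    obtain ⟨hmem, hmax⟩ := hMLE n s
    obtain ⟨t, ht, hr⟩ := hT (Ghat n s) ⟨hmem, hs⟩
    refine Set.mem_iUnion₂.2 ⟨t, ht, ?_⟩
    have hW0 : ∀ z : Euc d × ℝ, 0 ≤ Wf z := fun z => sq_nonneg _
    have hW : ∑ i, Wf (s i) < (n : ℝ) ^ 2 := by
      have h1 : ∑ i, ENNReal.ofReal (Wf (s i)) < ENNReal.ofReal ((n : ℝ) ^ 2) := not_le.1 hsE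
      rw [← ENNReal.ofReal_sum_of_nonneg (fun i _ => hW0 (s i))] at h1
      exact (ENNReal.ofReal_lt_ofReal_iff (by positivity)).1 h1
    have h2 := hmax ⟨K2 + 1, Gs⟩ ⟨by simp, hk2.le, hGs⟩
    have h3 : ∑ i, Real.log (pSL Gs (s i).1 (s i).2) ≤
        ∑ i, Real.log (pSL (Ghat n s).2 (s i).1 (s i).2) :=
      le_of_mul_le_mul_left h2 (by positivity)
    have htC := (hTB t ht).1
    have h4 : ∑ i, Real.log (pSL (Ghat n s).2 (s i).1 (s i).2) ≤
        ∑ i, (L * (1 / (n : ℝ) ^ 2) * Wf (s i) + Real.log (pSL t.2 (s i).1 (s i).2)) := by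
      refine Finset.sum_le_sum fun i _ => ?_
      have h5 := Real.log_le_log (hposC _ hmem (s i)) (hr (s i))
      rwa [Real.log_mul (Real.exp_pos _).ne' (hposC _ htC (s i)).ne', Real.log_exp] at h5
    rw [Finset.sum_add_distrib, ← Finset.mul_sum] at h4
    have h6 : L * (1 / (n : ℝ) ^ 2) * ∑ i, Wf (s i) ≤ L := by
      calc _ ≤ L * (1 / (n : ℝ) ^ 2) * (n : ℝ) ^ 2 := by gcongr
        _ = L := by field_simp
    have h7 : ∏ i, F t (s i) = ENNReal.ofReal (Real.exp
        (∑ i, (Real.log (pSL t.2 (s i).1 (s i).2) - Real.log (pSL Gs (s i).1 (s i).2)) / 2)) := by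
      rw [Real.exp_sum, ENNReal.ofReal_prod_of_nonneg fun i _ => (Real.exp_pos _).le]
      refine Finset.prod_congr rfl fun i _ => ?_
      simp only [hF]
      congr 1
      rw [← Real.log_div (hposC _ htC _).ne' (hpos0 _).ne', Real.exp_half,
        Real.exp_log (div_pos (hposC _ htC _) (hpos0 _))]
    show (1 : ENNReal) ≤ _
    rw [h7, ← ENNReal.ofReal_mul (Real.exp_pos _).le, ← Real.exp_add, ENNReal.one_le_ofReal,
      ← Finset.sum_div, Finset.sum_sub_distrib]
    refine Real.one_le_exp ?_
    linarith
  have hm0 : (Measure.pi fun _ : Fin n => ρ) E0 ≤ ENNReal.ofReal (M / n) := by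
    have hWm : Measurable fun z : Euc d × ℝ => ENNReal.ofReal (Wf z) := Wf_measurable.ennreal_ofReal
    have h1 := mul_meas_ge_le_lintegral₀ (μ := Measure.pi fun _ : Fin n => ρ)
      (f := fun s : Fin n → Euc d × ℝ => ∑ i, ENNReal.ofReal (Wf (s i)))
      (Finset.measurable_sum _ fun i _ => hWm.comp (measurable_pi_apply i)).aemeasurable
      (ENNReal.ofReal ((n : ℝ) ^ 2))
    rw [lintegral_pi_sum ρ n _ hWm] at h1
    have h2 : ENNReal.ofReal ((n : ℝ) ^ 2) * (Measure.pi fun _ : Fin n => ρ) E0 ≤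
        ENNReal.ofReal (n * M) := by
      refine h1.trans ?_
      rw [ENNReal.ofReal_mul hn0.le, ENNReal.ofReal_natCast]
      gcongr
    have h3 : ENNReal.ofReal (M / n) = ENNReal.ofReal (n * M) / ENNReal.ofReal ((n : ℝ) ^ 2) := by
      rw [← ENNReal.ofReal_div_of_pos (by positivity)]
      congr 1; field_simp
    rw [h3, ENNReal.le_div_iff_mul_le (Or.inl (by simp; omega)) (Or.inl ENNReal.ofReal_ne_top),
      mul_comm]
    exact h2
  have hm1 : ∀ t ∈ T, (Measure.pi fun _ : Fin n => ρ) (E1 t) ≤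
      ENNReal.ofReal (Real.exp L * Real.exp (-((D + 1) * Real.log n))) := by
    intro t ht
    obtain ⟨htC, htδ⟩ := hTB t ht
    have hPm : Measurable fun s : Fin n → Euc d × ℝ => ∏ i, F t (s i) :=
      Finset.measurable_prod _ fun i _ => (hFm t).comp (measurable_pi_apply i)
    have h1 := mul_meas_ge_le_lintegral₀ (μ := Measure.pi fun _ : Fin n => ρ)
      (f := fun s : Fin n → Euc d × ℝ => ENNReal.ofReal (Real.exp L) * ∏ i, F t (s i))
      (hPm.const_mul _).aemeasurable 1
    rw [one_mul, lintegral_const_mul _ hPm, lintegral_pi_prod ρ n _ (hFm t)] at h1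
    refine h1.trans ?_
    rw [ENNReal.ofReal_mul (Real.exp_pos _).le]
    gcongr
    have h2 : ∫⁻ z, F t z ∂ρ ≤ ENNReal.ofReal (Real.exp (-δ ^ 2)) := by
      obtain ⟨k, P⟩ := t
      have hk : NeZero k := ⟨by have := htC.1; simp only at this; omega⟩
      refine (affinity_le μ P Gs (fun i1 i2 => hΘν _ (htC.2.2 i1 i2)) hνs).trans ?_
      refine ENNReal.ofReal_le_ofReal (Real.exp_le_exp.2 ?_)
      have h3 : δ ^ 2 ≤ (∫ x, hellingerDist (pSL P x) (pSL Gs x) ∂μ) ^ 2 :=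
        pow_le_pow_left₀ hδ0 htδ.le 2
      linarith
    calc _ ≤ ENNReal.ofReal (Real.exp (-δ ^ 2)) ^ n := by gcongr
      _ = _ := by
        rw [← ENNReal.ofReal_pow (Real.exp_pos _).le, ← Real.exp_nat_mul, ← hδ2]
        congr 2; ring
  have hexp : Real.exp (-((D + 1) * Real.log n)) = 1 / (n : ℝ) ^ (D + 1) := by
    rw [Real.exp_neg, one_div]
    congr 1
    have : ((D : ℝ) + 1) * Real.log n = ((D + 1 : ℕ) : ℝ) * Real.log n := by push_cast; ring
    rw [this, Real.exp_nat_mul, Real.exp_log hn0]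
  calc _ ≤ (Measure.pi fun _ : Fin n => ρ) (E0 ∪ ⋃ t ∈ T, E1 t) := measure_mono hsub
    _ ≤ (Measure.pi fun _ : Fin n => ρ) E0 + (Measure.pi fun _ : Fin n => ρ) (⋃ t ∈ T, E1 t) :=
        measure_union_le _ _
    _ ≤ ENNReal.ofReal (M / n) + ∑ t ∈ T, (Measure.pi fun _ : Fin n => ρ) (E1 t) :=
        add_le_add hm0 (measure_biUnion_finset_le _ _)
    _ ≤ ENNReal.ofReal (M / n) +
        ∑ t ∈ T, ENNReal.ofReal (Real.exp L * Real.exp (-((D + 1) * Real.log n))) := by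
        gcongr with t ht
        exact hm1 t ht
    _ = ENNReal.ofReal (M / n + T.card * (Real.exp L * Real.exp (-((D + 1) * Real.log n)))) := by
        rw [Finset.sum_const, nsmul_eq_mul, ENNReal.ofReal_add (by positivity) (by positivity),
          ENNReal.ofReal_mul (p := (T.card : ℝ)) (by positivity), ENNReal.ofReal_natCast]
    _ ≤ _ := by
        refine ENNReal.ofReal_le_ofReal ?_
        rw [hexp, one_mul, Real.exp_neg, Real.exp_log hn0]
        have h1 : (T.card : ℝ) * (Real.exp L * (1 / (n : ℝ) ^ (D + 1))) ≤
            (A * (n : ℝ) ^ D) * (Real.exp L * (1 / (n : ℝ) ^ (D + 1))) := by gcongr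
        have h2 : (A * (n : ℝ) ^ D) * (Real.exp L * (1 / (n : ℝ) ^ (D + 1))) =
            A * Real.exp L * (n : ℝ)⁻¹ := by
          rw [pow_succ]; field_simp
        have h3 : M / n = M * (n : ℝ)⁻¹ := div_eq_mul_inv _ _
        have h4 : 0 < (n : ℝ)⁻¹ := by positivity
        nlinarith
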